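/- arXiv:1012.3116 — 4 statements merged into one kernel-verified Lean document; each statement's English description precedes it below -/
import Mathlib

section
/- In BW_3, the left ideal BW_3·e_2 equals the Λ-submodule spanned by the three elements e_2, e_1 e_2, and g_1 e_2; in particular BW_3·e_2 = ι(BW_2)·e_2, where ι : BW_2 → BW_3 is the Λ-algebra homomorphism with ι(g_1) = g_1 and ι(e_1) = e_1. -/
noncomputable section

open MvPolynomial

/-- Polynomial ring ℤ[l, linv, z, d] with variables 0 = λ, 1 = λ⁻¹, 2 = z, 3 = δ. -/
abbrev LambdaPoly : Type := MvPolynomial (Fin 4) ℤ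

/-- The ideal ⟨λ·λ⁻¹ − 1, λ⁻¹ − λ − z(δ − 1)⟩. -/
def lambdaIdeal : Ideal LambdaPoly :=
  Ideal.span {X 0 * X 1 - 1, X 1 - X 0 - X 2 * (X 3 - 1)}

/-- The coefficient ring Λ = ℤ[λ^{±1}, z, δ]/⟨λ⁻¹ − λ − z(δ−1)⟩. -/
abbrev Lambda : Type := LambdaPoly ⧸ lambdaIdeal

def lam : Lambda := Ideal.Quotient.mk lambdaIdeal (X 0)
def lamInv : Lambda := Ideal.Quotient.mk lambdaIdeal (X 1)
def zz : Lambda := Ideal.Quotient.mk lambdaIdeal (X 2)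
def del : Lambda := Ideal.Quotient.mk lambdaIdeal (X 3)

/-- Generators of the Birman–Wenzl algebra: gᵢ, gᵢ⁻¹ and eᵢ. -/
inductive BWGen : Type
  | g (i : ℕ)
  | ginv (i : ℕ)
  | e (i : ℕ)

abbrev BWFree : Type := FreeAlgebra Lambda BWGen

def Gf (i : ℕ) : BWFree := FreeAlgebra.ι Lambda (BWGen.g i)
def Gif (i : ℕ) : BWFree := FreeAlgebra.ι Lambda (BWGen.ginv i)
def Ef (i : ℕ) : BWFree := FreeAlgebra.ι Lambda (BWGen.e i)
def cf (a : Lambda) : BWFree := algebraMap Lambda BWFree a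

/-- The defining relations of the Birman–Wenzl algebra BW_n.  Generators with
index outside the range 1 ≤ i ≤ n−1 are killed (identified with 1 resp. 0), so
the resulting algebra is exactly the algebra presented by g₁,…,g_{n−1} (invertible)
and e₁,…,e_{n−1} with the Birman–Wenzl relations. -/
inductive BWRel (n : ℕ) : BWFree → BWFree → Prop
  | g_out (i : ℕ) (h : ¬(1 ≤ i ∧ i < n)) : BWRel n (Gf i) 1
  | ginv_out (i : ℕ) (h : ¬(1 ≤ i ∧ i < n)) : BWRel n (Gif i) 1
  | e_out (i : ℕ) (h : ¬(1 ≤ i ∧ i < n)) : BWRel n (Ef i) 0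
  | g_mul_ginv (i : ℕ) (h : 1 ≤ i ∧ i < n) : BWRel n (Gf i * Gif i) 1
  | ginv_mul_g (i : ℕ) (h : 1 ≤ i ∧ i < n) : BWRel n (Gif i * Gf i) 1
  /-- (1) Kauffman skein relation gᵢ − gᵢ⁻¹ = z(1 − eᵢ) -/
  | skein (i : ℕ) (h : 1 ≤ i ∧ i < n) :
      BWRel n (Gf i - Gif i) (cf zz * (1 - Ef i))
  /-- (2) idempotent relation eᵢ² = δ eᵢ -/
  | idem (i : ℕ) (h : 1 ≤ i ∧ i < n) : BWRel n (Ef i * Ef i) (cf del * Ef i)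
  /-- (3) braid relations -/
  | braid (i : ℕ) (h : 1 ≤ i ∧ i + 1 < n) :
      BWRel n (Gf i * Gf (i+1) * Gf i) (Gf (i+1) * Gf i * Gf (i+1))
  | comm (i j : ℕ) (hi : 1 ≤ i ∧ i < n) (hj : 1 ≤ j ∧ j < n)
      (hij : i + 1 < j ∨ j + 1 < i) : BWRel n (Gf i * Gf j) (Gf j * Gf i)
  /-- (4) tangle relations -/
  | tangle_e (i j : ℕ) (hi : 1 ≤ i ∧ i < n) (hj : 1 ≤ j ∧ j < n)
      (hij : j = i + 1 ∨ i = j + 1) : BWRel n (Ef i * Ef j * Ef i) (Ef i)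
  | tangle_g (i j : ℕ) (hi : 1 ≤ i ∧ i < n) (hj : 1 ≤ j ∧ j < n)
      (hij : j = i + 1 ∨ i = j + 1) : BWRel n (Gf i * Gf j * Ef i) (Ef j * Ef i)
  /-- (5) delooping relations -/
  | deloop_ge (i : ℕ) (h : 1 ≤ i ∧ i < n) : BWRel n (Gf i * Ef i) (cf lam * Ef i)
  | deloop_eg (i : ℕ) (h : 1 ≤ i ∧ i < n) : BWRel n (Ef i * Gf i) (cf lam * Ef i)
  | deloop_ege (i j : ℕ) (hi : 1 ≤ i ∧ i < n) (hj : 1 ≤ j ∧ j < n)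
      (hij : j = i + 1 ∨ i = j + 1) :
      BWRel n (Ef i * Gf j * Ef i) (cf lamInv * Ef i)

/-- The Birman–Wenzl algebra BW_n as a quotient of the free Λ-algebra. -/
abbrev BW (n : ℕ) : Type := RingQuot (BWRel n)

/-- The generator gᵢ of BW_n. -/
def bwG (n i : ℕ) : BW n := RingQuot.mkAlgHom Lambda (BWRel n) (Gf i)
/-- The generator gᵢ⁻¹ of BW_n. -/
def bwGinv (n i : ℕ) : BW n := RingQuot.mkAlgHom Lambda (BWRel n) (Gif i)
/-- The generator eᵢ of BW_n. -/
def bwE (n i : ℕ) : BW n := RingQuot.mkAlgHom Lambda (BWRel n) (Ef i)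

/-- a_m = g_m g_{m−1} ⋯ g_1 in BW_n (with a_0 = 1). -/
def aElt (n : ℕ) : ℕ → BW n
  | 0 => 1
  | (m+1) => bwG n (m+1) * aElt n m

/-- b_m = g_m⁻¹ g_{m−1}⁻¹ ⋯ g_1⁻¹ in BW_n (with b_0 = 1). -/
def bElt (n : ℕ) : ℕ → BW n
  | 0 => 1
  | (m+1) => bwGinv n (m+1) * bElt n m

/-- f_k in BW_n, defined relative to the reversing anti-automorphism α by
f_0 = 1 and f_k = α(a_{2k−2}) f_{k−1} e_{2k−1} a_{2k−2}. -/
def fElt (n : ℕ) (α : BW n →ₗ[Lambda] BW n) : ℕ → BW n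
  | 0 => 1
  | (k+1) => α (aElt n (2*k)) * fElt n α k * bwE n (2*k+1) * aElt n (2*k)


/-- Closure of a submodule under left multiplication, checked on three spanning vectors. -/
theorem gen_closed {R A : Type} [CommRing R] [Ring A] [Algebra R A] (u v w a : A)
    (V : Submodule R A) (hV : V = Submodule.span R {u, v, w})
    (h1 : a * u ∈ V) (h2 : a * v ∈ V) (h3 : a * w ∈ V) (x : A) (hx : x ∈ V) : a * x ∈ V := by
  have : Submodule.span R {u, v, w} ≤ V.comap (LinearMap.mulLeft R a) := by
    rw [Submodule.span_le]
    rintro x (rfl | rfl | rfl)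
    · exact h1
    · exact h2
    · exact h3
  exact this (hV ▸ hx)

/-- The main computation, over an arbitrary commutative ring. -/
theorem gen_main {R A : Type} [CommRing R] [Ring A] [Algebra R A]
    (lm li z d : R) (φ : FreeAlgebra R BWGen →ₐ[R] A) (hφ : Function.Surjective φ)
    (g gi e : ℕ → A)
    (hg : ∀ i, φ (FreeAlgebra.ι R (BWGen.g i)) = g i)
    (hgi : ∀ i, φ (FreeAlgebra.ι R (BWGen.ginv i)) = gi i)
    (he : ∀ i, φ (FreeAlgebra.ι R (BWGen.e i)) = e i)
    (g_out : ∀ i, ¬ (1 ≤ i ∧ i < 3) → g i = 1)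
    (gi_out : ∀ i, ¬ (1 ≤ i ∧ i < 3) → gi i = 1)
    (e_out : ∀ i, ¬ (1 ≤ i ∧ i < 3) → e i = 0)
    (ggi : ∀ i, (1 ≤ i ∧ i < 3) → g i * gi i = 1)
    (skein : ∀ i, (1 ≤ i ∧ i < 3) →
      φ (FreeAlgebra.ι R (BWGen.g i) - FreeAlgebra.ι R (BWGen.ginv i)) =
      φ (algebraMap R _ z * (1 - FreeAlgebra.ι R (BWGen.e i))))
    (ee : ∀ i, (1 ≤ i ∧ i < 3) → e i * e i = algebraMap R A d * e i)
    (ge : ∀ i, (1 ≤ i ∧ i < 3) → g i * e i = algebraMap R A lm * e i)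
    (eg : ∀ i, (1 ≤ i ∧ i < 3) → e i * g i = algebraMap R A lm * e i)
    (e212 : e 2 * e 1 * e 2 = e 2) (g21e2 : g 2 * g 1 * e 2 = e 1 * e 2)
    (e2g1e2 : e 2 * g 1 * e 2 = algebraMap R A li * e 2) :
    ∀ y : A, y * e 2 ∈ Submodule.span R ({e 2, e 1 * e 2, g 1 * e 2} : Set A) := by
  simp only [← Algebra.smul_def] at ee ge eg e2g1e2
  rw [mul_assoc] at e212 g21e2 e2g1e2
  have gi_eq : ∀ i, (1 ≤ i ∧ i < 3) → gi i = g i - z • (1 - e i) := by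
    intro i h
    have := skein i h
    rw [map_sub, map_mul, AlgHom.commutes, map_sub, map_one, hg, hgi, he,
      ← Algebra.smul_def] at this
    rw [← this]; abel
  have gg : ∀ i, (1 ≤ i ∧ i < 3) → g i * g i = 1 + z • g i - (z * lm) • e i := by
    intro i h
    have := ggi i h
    rw [gi_eq i h, mul_sub, mul_smul_comm, mul_sub, mul_one, ge i h, smul_sub,
      smul_smul, sub_eq_iff_eq_add] at this
    rw [this]; abel
  have g2e1e2 : g 2 * (e 1 * e 2) =
      g 1 * e 2 + z • (e 1 * e 2) - (z * lm) • li • e 2 := by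
    conv_lhs => rw [← g21e2, ← mul_assoc (g 2) (g 2), gg 2 (by omega), sub_mul, add_mul,
      one_mul, smul_mul_assoc, smul_mul_assoc, e2g1e2, g21e2]
  generalize hV : Submodule.span R ({e 2, e 1 * e 2, g 1 * e 2} : Set A) = V
  have V1 : e 2 ∈ V := hV ▸ Submodule.subset_span (by simp)
  have V2 : e 1 * e 2 ∈ V := hV ▸ Submodule.subset_span (by simp)
  have V3 : g 1 * e 2 ∈ V := hV ▸ Submodule.subset_span (by simp)
  have cl := fun a => gen_closed (e 2) (e 1 * e 2) (g 1 * e 2) a V hV.symm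
  have VE : ∀ i, ∀ v ∈ V, e i * v ∈ V := by
    intro i
    by_cases h : 1 ≤ i ∧ i < 3
    · have : i = 1 ∨ i = 2 := by omega
      rcases this with rfl | rfl
      · apply cl
        · exact V2
        · rw [← mul_assoc, ee 1 h, smul_mul_assoc]
          exact V.smul_mem _ V2
        · rw [← mul_assoc, eg 1 h, smul_mul_assoc]
          exact V.smul_mem _ V2
      · apply cl
        · rw [ee 2 h]
          exact V.smul_mem _ V1
        · rw [e212]
          exact V1
        · rw [e2g1e2]
          exact V.smul_mem _ V1
    · intro v _
      rw [e_out i h, zero_mul]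
      exact V.zero_mem
  have VG : ∀ i, ∀ v ∈ V, g i * v ∈ V := by
    intro i
    by_cases h : 1 ≤ i ∧ i < 3
    · have : i = 1 ∨ i = 2 := by omega
      rcases this with rfl | rfl
      · apply cl
        · exact V3
        · rw [← mul_assoc, ge 1 h, smul_mul_assoc]
          exact V.smul_mem _ V2
        · rw [← mul_assoc, gg 1 h, sub_mul, add_mul, one_mul, smul_mul_assoc, smul_mul_assoc]
          exact V.sub_mem (V.add_mem V1 (V.smul_mem _ V3)) (V.smul_mem _ V2)
      · apply cl
        · rw [ge 2 h]
          exact V.smul_mem _ V1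
        · rw [g2e1e2]
          exact V.sub_mem (V.add_mem V3 (V.smul_mem _ V2))
            (V.smul_mem _ (V.smul_mem _ V1))
        · rw [g21e2]
          exact V2
    · intro v hv
      rw [g_out i h, one_mul]
      exact hv
  have VGi : ∀ i, ∀ v ∈ V, gi i * v ∈ V := by
    intro i v hv
    by_cases h : 1 ≤ i ∧ i < 3
    · rw [gi_eq i h, sub_mul, smul_mul_assoc, sub_mul, one_mul]
      exact V.sub_mem (VG i v hv) (V.smul_mem _ (V.sub_mem hv (VE i v hv)))
    · rw [gi_out i h, one_mul]
      exact hv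
  have all : ∀ y : A, ∀ v ∈ V, y * v ∈ V := by
    intro y
    obtain ⟨p, rfl⟩ := hφ y
    induction p using FreeAlgebra.induction with
    | grade0 r =>
      intro v hv
      rw [AlgHom.commutes, ← Algebra.smul_def]
      exact V.smul_mem _ hv
    | grade1 x =>
      cases x with
      | g i => rw [hg]; exact VG i
      | ginv i => rw [hgi]; exact VGi i
      | e i => rw [he]; exact VE i
    | mul a b ha hb =>
      intro v hv
      rw [map_mul, mul_assoc]
      exact ha _ (hb _ hv)
    | add a b ha hb =>
      intro v hv
      rw [map_add, add_mul]
      exact V.add_mem (ha _ hv) (hb _ hv)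
  exact fun y => all y _ V1

theorem gen_exists {R A : Type} [CommSemiring R] [Semiring A] [Algebra R A] (E F G x : A)
    (hx : x ∈ Submodule.span R ({E, F * E, G * E} : Set A)) :
    ∃ y : A, x = y * E := by
  rw [Submodule.mem_span_triple] at hx
  obtain ⟨a, b, c, rfl⟩ := hx
  exact ⟨a • 1 + b • F + c • G, by simp only [add_mul, smul_mul_assoc, one_mul]⟩

theorem gen_exists_map {R A B : Type} [CommSemiring R] [Semiring A] [Algebra R A]
    [Semiring B] [Algebra R B] (f : B →ₐ[R] A) (F' G' : B) (E F G x : A)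
    (hG : f G' = G) (hF : f F' = F)
    (hx : x ∈ Submodule.span R ({E, F * E, G * E} : Set A)) :
    ∃ y : B, x = f y * E := by
  rw [Submodule.mem_span_triple] at hx
  obtain ⟨a, b, c, rfl⟩ := hx
  exact ⟨a • 1 + b • F' + c • G', by
    simp only [map_add, map_smul, map_one, hF, hG, add_mul, smul_mul_assoc, one_mul]⟩

theorem bw_rel {n : ℕ} {a b : BWFree} (h : BWRel n a b) :
    RingQuot.mkAlgHom Lambda (BWRel n) a = RingQuot.mkAlgHom Lambda (BWRel n) b :=
  RingQuot.mkAlgHom_rel Lambda h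

theorem bw_mul_rel {n : ℕ} {a b c : BWFree} (h : BWRel n (a * b) c) :
    RingQuot.mkAlgHom Lambda (BWRel n) a * RingQuot.mkAlgHom Lambda (BWRel n) b =
      RingQuot.mkAlgHom Lambda (BWRel n) c :=
  (map_mul _ _ _).symm.trans (bw_rel h)

theorem bw_mul3_rel {n : ℕ} {a b c d : BWFree} (h : BWRel n (a * b * c) d) :
    RingQuot.mkAlgHom Lambda (BWRel n) a * RingQuot.mkAlgHom Lambda (BWRel n) b *
      RingQuot.mkAlgHom Lambda (BWRel n) c = RingQuot.mkAlgHom Lambda (BWRel n) d := by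
  rw [← map_mul]
  exact bw_mul_rel h

theorem bw_cf_mul (n : ℕ) (r : Lambda) (a : BWFree) :
    RingQuot.mkAlgHom Lambda (BWRel n) (cf r * a) =
      algebraMap Lambda (BW n) r * RingQuot.mkAlgHom Lambda (BWRel n) a := by
  rw [map_mul, cf, AlgHom.commutes]

theorem bw_span (y : BW 3) : y * bwE 3 2 ∈ Submodule.span Lambda
        ({bwE 3 2, bwE 3 1 * bwE 3 2, bwG 3 1 * bwE 3 2} : Set (BW 3)) := by
  refine @gen_main Lambda (BW 3) (Ideal.Quotient.commRing lambdaIdeal)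
    (@Algebra.semiringToRing (BW 3) Lambda (Ideal.Quotient.commRing lambdaIdeal) _ _)
    (RingQuot.instAlgebra (BWRel 3)) lam lamInv zz del
    (RingQuot.mkAlgHom Lambda (BWRel 3)) (RingQuot.mkAlgHom_surjective Lambda (BWRel 3))
    (bwG 3) (bwGinv 3) (bwE 3) (fun _ => rfl) (fun _ => rfl) (fun _ => rfl)
    ?_ ?_ ?_ ?_ ?_ ?_ ?_ ?_ ?_ ?_ ?_ y
  · exact fun i h => (bw_rel (BWRel.g_out i h)).trans (map_one _)
  · exact fun i h => (bw_rel (BWRel.ginv_out i h)).trans (map_one _)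
  · exact fun i h => (bw_rel (BWRel.e_out i h)).trans (map_zero _)
  · exact fun i h => (bw_mul_rel (BWRel.g_mul_ginv i h)).trans (map_one _)
  · exact fun i h => bw_rel (BWRel.skein i h)
  · exact fun i h => (bw_mul_rel (BWRel.idem i h)).trans (bw_cf_mul _ _ _)
  · exact fun i h => (bw_mul_rel (BWRel.deloop_ge i h)).trans (bw_cf_mul _ _ _)
  · exact fun i h => (bw_mul_rel (BWRel.deloop_eg i h)).trans (bw_cf_mul _ _ _)
  · exact bw_mul3_rel (BWRel.tangle_e 2 1 (by omega) (by omega) (by omega))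
  · exact (bw_mul3_rel (BWRel.tangle_g 2 1 (by omega) (by omega) (by omega))).trans (map_mul _ _ _)
  · exact (bw_mul3_rel (BWRel.deloop_ege 2 1 (by omega) (by omega) (by omega))).trans
      (bw_cf_mul _ _ _)

/-- in BW₃ the left ideal BW₃·e₂ is the Λ-submodule spanned by
e₂, e₁e₂ and g₁e₂; in particular BW₃·e₂ = ι(BW₂)·e₂ for the Λ-algebra
homomorphism ι : BW₂ → BW₃ with ι(g₁) = g₁ and ι(e₁) = e₁. -/
theorem statement7 :
    (∀ x : BW 3, (∃ y : BW 3, x = y * bwE 3 2) ↔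
      x ∈ Submodule.span Lambda
        ({bwE 3 2, bwE 3 1 * bwE 3 2, bwG 3 1 * bwE 3 2} : Set (BW 3))) ∧
    (∀ ι : BW 2 →ₐ[Lambda] BW 3, ι (bwG 2 1) = bwG 3 1 → ι (bwE 2 1) = bwE 3 1 →
      ∀ x : BW 3, (∃ y : BW 3, x = y * bwE 3 2) ↔ ∃ w : BW 2, x = ι w * bwE 3 2) := by
  refine ⟨fun x => ⟨?_, fun hx => gen_exists _ _ _ x hx⟩, fun ι hg he x => ⟨?_, ?_⟩⟩
  · rintro ⟨y, rfl⟩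
    exact bw_span y
  · rintro ⟨y, rfl⟩
    exact gen_exists_map ι _ _ _ _ _ _ hg he (bw_span y)
  · rintro ⟨w, rfl⟩
    exact ⟨ι w, rfl⟩
end
end

section
/- The ring homomorphism from Λ to the Laurent polynomial ring ℤ[λ^{±1}, z^{±1}] in two variables, determined by λ ↦ λ, z ↦ z, and δ ↦ 1 + (λ^{-1} − λ)·z^{-1}, is well-defined and injective; hence Λ is isomorphic to a subring of ℤ[λ^{±1}, z^{±1}]. -/
noncomputable section

open MvPolynomial

open LaurentPolynomial in
/-- The map on polynomials. -/
def polyMap : LambdaPoly →+* LaurentPolynomial (LaurentPolynomial ℤ) :=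
  MvPolynomial.eval₂Hom (Int.castRingHom _)
    ![LaurentPolynomial.C (T 1), LaurentPolynomial.C (T (-1)), T 1,
      1 + (LaurentPolynomial.C (T (-1)) - LaurentPolynomial.C (T 1)) * T (-1)]

lemma polyMap_ideal : ∀ a ∈ lambdaIdeal, polyMap a = 0 := by
  have : lambdaIdeal ≤ RingHom.ker polyMap := by
    unfold lambdaIdeal
    rw [Ideal.span_le]
    rintro x (rfl | rfl)
    · have h : (LaurentPolynomial.T 1 * LaurentPolynomial.T (-1) : LaurentPolynomial ℤ) = 1 := by
        rw [← LaurentPolynomial.T_add]; simp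
      simp only [polyMap, SetLike.mem_coe, RingHom.mem_ker, map_sub, map_mul, coe_eval₂Hom,
        eval₂_X, map_one]
      simp only [Matrix.cons_val]
      rw [← map_mul, h, map_one, sub_self]
    · have h : (LaurentPolynomial.T 1 * LaurentPolynomial.T (-1) :
          LaurentPolynomial (LaurentPolynomial ℤ)) = 1 := by
        rw [← LaurentPolynomial.T_add]; simp
      simp only [polyMap, SetLike.mem_coe, RingHom.mem_ker, map_sub, map_mul, coe_eval₂Hom,
        eval₂_X, map_one]
      simp only [Matrix.cons_val]
      linear_combination (-(LaurentPolynomial.C (LaurentPolynomial.T (-1))) +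
        LaurentPolynomial.C (LaurentPolynomial.T 1)) * h
  exact this

def lamMap : Lambda →+* LaurentPolynomial (LaurentPolynomial ℤ) :=
  Ideal.Quotient.lift lambdaIdeal polyMap polyMap_ideal

lemma lamMap_lam : lamMap lam = LaurentPolynomial.C (LaurentPolynomial.T 1) := by
  simp [lamMap, lam, polyMap]
lemma lamMap_lamInv : lamMap lamInv = LaurentPolynomial.C (LaurentPolynomial.T (-1)) := by
  simp [lamMap, lamInv, polyMap]
lemma lamMap_zz : lamMap zz = LaurentPolynomial.T 1 := by
  simp [lamMap, zz, polyMap]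
lemma lamMap_del : lamMap del = 1 + (LaurentPolynomial.C (LaurentPolynomial.T (-1)) -
        LaurentPolynomial.C (LaurentPolynomial.T 1)) * LaurentPolynomial.T (-1) := by
  simp [lamMap, del, polyMap]

lemma lam_mul : lam * lamInv = 1 := by
  rw [lam, lamInv, ← map_mul, ← map_one (Ideal.Quotient.mk lambdaIdeal), Ideal.Quotient.eq]
  exact Ideal.subset_span (by simp)

lemma zz_mul : zz * (del - 1) = lamInv - lam := by
  symm
  rw [lam, lamInv, zz, del, ← map_one (Ideal.Quotient.mk lambdaIdeal), ← map_sub, ← map_sub,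
    ← map_mul, Ideal.Quotient.eq]
  exact Ideal.subset_span (by simp)

def lamUnit : Lambdaˣ := ⟨lam, lamInv, lam_mul, by rw [mul_comm, lam_mul]⟩

def gg : LaurentPolynomial ℤ →+* Lambda :=
  LaurentPolynomial.eval₂ (Int.castRingHom _) lamUnit

lemma gg_T : gg (LaurentPolynomial.T 1) = lam := by
  simp [gg, lamUnit]
lemma gg_T' : gg (LaurentPolynomial.T (-1)) = lamInv := by
  simp [gg, lamUnit]

lemma lamMap_gg (r : LaurentPolynomial ℤ) : lamMap (gg r) = LaurentPolynomial.C r := by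
  induction r using LaurentPolynomial.induction_on with
  | h_C a => simp [gg]
  | h_add hp hq => rw [map_add, map_add, map_add, hp, hq]
  | h_C_mul_T n a h =>
    rw [LaurentPolynomial.T_add, ← mul_assoc, map_mul, map_mul, h, gg_T, lamMap_lam, ← map_mul]
  | h_C_mul_T_Z n a h =>
    rw [LaurentPolynomial.T_sub, ← mul_assoc, map_mul, map_mul, h, gg_T', lamMap_lamInv, ← map_mul]

def mm : ℤ → Lambda
  | .ofNat k => zz ^ k
  | .negSucc k => (del - 1) ^ (k + 1)

def aa : LaurentPolynomial ℤ := LaurentPolynomial.T (-1) - LaurentPolynomial.T 1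

lemma gg_aa : gg aa = zz * (del - 1) := by
  rw [aa, map_sub, gg_T, gg_T', zz_mul]

lemma aa_ne : aa ≠ 0 := by
  intro h
  have := congrArg (fun p => AddMonoidAlgebra.coeff p 1) h
  simp [aa] at this

def bb : ℤ → LaurentPolynomial ℤ
  | .ofNat _ => 1
  | .negSucc k => aa ^ (k + 1)

lemma bb_ne (n : ℤ) : bb n ≠ 0 := by
  cases n with
  | ofNat k => exact one_ne_zero
  | negSucc k => exact pow_ne_zero _ aa_ne

lemma lamMap_mm (n : ℤ) :
    lamMap (mm n) = LaurentPolynomial.C (bb n) * LaurentPolynomial.T n := by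
  cases n with
  | ofNat k => simp [mm, bb, lamMap_zz, LaurentPolynomial.T_pow]
  | negSucc k =>
    simp only [mm, bb, map_pow, map_sub, lamMap_del, map_one, add_sub_cancel_left, mul_pow, aa,
      LaurentPolynomial.T_pow]
    congr 2
    rw [Int.negSucc_eq]; push_cast; ring

def phi : (ℤ →₀ LaurentPolynomial ℤ) →+ Lambda :=
  Finsupp.liftAddHom (fun n => (AddMonoidHom.mulRight (mm n)).comp gg.toAddMonoidHom)

lemma phi_single (n : ℤ) (r : LaurentPolynomial ℤ) :
    phi (Finsupp.single n r) = gg r * mm n := by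
  simp [phi]

lemma coeff_phi (c : ℤ →₀ LaurentPolynomial ℤ) (n : ℤ) :
    (lamMap (phi c)).coeff n = c n * bb n := by
  induction c using Finsupp.induction_linear with
  | zero => simp
  | add f g hf hg => simp [hf, hg, add_mul]
  | single k r =>
    rw [phi_single, map_mul, lamMap_gg, lamMap_mm, ← mul_assoc, ← map_mul,
      ← LaurentPolynomial.single_eq_C_mul_T]
    by_cases h : k = n
    · subst h; rw [AddMonoidAlgebra.coeff_single]; simp
    · rw [AddMonoidAlgebra.coeff_single]; simp [h]

lemma mem_single (n : ℤ) (r : LaurentPolynomial ℤ) : gg r * mm n ∈ phi.range :=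
  ⟨Finsupp.single n r, phi_single n r⟩

lemma closed_of (y : Lambda) (h : ∀ n, ∃ r k, mm n * y = gg r * mm k) (x : Lambda)
    (hx : x ∈ phi.range) : x * y ∈ phi.range := by
  obtain ⟨c, rfl⟩ := hx
  induction c using Finsupp.induction_linear with
  | zero => simp
  | add f g hf hg => rw [map_add, add_mul]; exact add_mem hf hg
  | single k r =>
    obtain ⟨s, j, e⟩ := h k
    rw [phi_single, mul_assoc, e, ← mul_assoc, ← map_mul]
    exact mem_single _ _

lemma closed_lam : ∀ x ∈ phi.range, x * lam ∈ phi.range := closed_of lam (fun n => ⟨LaurentPolynomial.T 1, n, by rw [gg_T, mul_comm]⟩)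
lemma closed_lamInv : ∀ x ∈ phi.range, x * lamInv ∈ phi.range :=
  closed_of lamInv (fun n => ⟨LaurentPolynomial.T (-1), n, by rw [gg_T', mul_comm]⟩)

lemma closed_zz : ∀ x ∈ phi.range, x * zz ∈ phi.range := closed_of zz (by
  rintro (k | _ | k)
  · exact ⟨1, .ofNat (k + 1), by simp only [mm, map_one]; ring⟩
  · exact ⟨aa, .ofNat 0, by simp only [mm, gg_aa]; ring⟩
  · exact ⟨aa, .negSucc k, by simp only [mm, gg_aa]; ring⟩)

lemma closed_ee : ∀ x ∈ phi.range, x * (del - 1) ∈ phi.range := closed_of (del - 1) (by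
  rintro ((_ | k) | k)
  · exact ⟨1, .negSucc 0, by simp only [mm, map_one]; ring⟩
  · exact ⟨aa, .ofNat k, by simp only [mm, gg_aa]; ring⟩
  · exact ⟨1, .negSucc (k + 1), by simp only [mm, map_one]; ring⟩)

lemma phi_surj (x : Lambda) : x ∈ phi.range := by
  obtain ⟨p, rfl⟩ := Ideal.Quotient.mk_surjective x
  induction p using MvPolynomial.induction_on with
  | C a =>
    have := mem_single (.ofNat 0) (LaurentPolynomial.C a)
    simpa [mm, gg] using this
  | add p q hp hq => rw [map_add]; exact add_mem hp hq
  | mul_X p i h =>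
    rw [map_mul]
    fin_cases i
    · exact closed_lam _ h
    · exact closed_lamInv _ h
    · exact closed_zz _ h
    · have := add_mem (closed_ee _ h) h
      rw [mul_sub, mul_one, sub_add_cancel] at this
      exact this

lemma lamMap_inj : Function.Injective lamMap := by
  rw [injective_iff_map_eq_zero]
  intro x hx
  obtain ⟨c, rfl⟩ := phi_surj x
  have : c = 0 := by
    ext1 n
    have h := coeff_phi c n
    rw [hx] at h
    simpa [bb_ne n] using h.symm
  rw [this, map_zero]

/-- the ring homomorphism Λ → ℤ[λ^{±1}, z^{±1}] determined by
λ ↦ λ, z ↦ z and δ ↦ 1 + (λ⁻¹ − λ)z⁻¹ is well-defined and injective, so Λ is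
isomorphic to a subring of the two-variable Laurent polynomial ring.
Here ℤ[λ^{±1}, z^{±1}] is realised as (ℤ[λ^{±1}])[z^{±1}], with the outer
Laurent variable `T` playing the role of z and `C (T 1)` the role of λ. -/
theorem statement9 :
    ∃ f : Lambda →+* LaurentPolynomial (LaurentPolynomial ℤ),
      f lam = LaurentPolynomial.C (LaurentPolynomial.T 1) ∧
      f lamInv = LaurentPolynomial.C (LaurentPolynomial.T (-1)) ∧
      f zz = LaurentPolynomial.T 1 ∧
      f del = 1 + (LaurentPolynomial.C (LaurentPolynomial.T (-1)) -
        LaurentPolynomial.C (LaurentPolynomial.T 1)) * LaurentPolynomial.T (-1) ∧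
      Function.Injective f := by
  exact ⟨lamMap, lamMap_lam, lamMap_lamInv, lamMap_zz, lamMap_del, lamMap_inj⟩
end
end

section
/- For every n ≥ 0 the identity c_n = Σ_{k=0}^{⌊n/2⌋} C(n, n−2k)² · c_k² · (n−2k)! holds, where c_m = (2m)!/(2^m · m!) and C(n, r) is the binomial coefficient. (This expresses the count of n-connectors according to the number r = n−2k of pairs joining the top n points to the bottom n points.) -/
/-- c_m = (2m)!/(2^m·m!), the number of m-connectors. -/
def connCount (m : ℕ) : ℕ := Nat.factorial (2*m) / (2^m * Nat.factorial m)

lemma cc_mul (m : ℕ) : connCount m * (2^m * Nat.factorial m) = Nat.factorial (2*m) := by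
  unfold connCount
  apply Nat.div_mul_cancel
  induction m with
  | zero => simp
  | succ m ih =>
    obtain ⟨c, hc⟩ := ih
    refine ⟨(2*m+1) * c, ?_⟩
    rw [show 2*(m+1) = 2*m+1+1 by ring, Nat.factorial_succ, Nat.factorial_succ, hc,
      Nat.factorial_succ]
    ring

lemma sum_even (n : ℕ) (f : ℕ → ℕ) :
    ∑ j ∈ Finset.range (n+1), (if 2 ∣ j then f j else 0) =
      ∑ k ∈ Finset.range (n/2+1), f (2*k) := by
  rw [← Finset.sum_filter]
  symm
  apply Finset.sum_nbij (fun k => 2*k)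
  · intro k hk
    simp at hk ⊢
    omega
  · intro a _ b _ h
    simpa using h
  · intro j hj
    simp at hj
    obtain ⟨h1, c, rfl⟩ := hj
    refine ⟨c, ?_, rfl⟩
    simp
    omega
  · intros; rfl

open Polynomial in
lemma central (n : ℕ) : (2*n).choose n =
    ∑ k ∈ Finset.range (n/2+1), n.choose (2*k) * 2^(n-2*k) * (2*k).choose k := by
  have h1 : ((1 + X : ℕ[X])^(2*n)).coeff n = (2*n).choose n := by
    simp [coeff_one_add_X_pow]
  have h2 : ((1 + X : ℕ[X])^(2*n)) = ∑ j ∈ Finset.range (n+1),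
      C (n.choose j * 2^(n-j)) * (expand ℕ 2 ((1+X)^j) * X^(n-j)) := by
    rw [pow_mul, show (1 + X : ℕ[X])^2 = (1 + X^2) + C 2 * X by
      rw [show (C 2 : ℕ[X]) = 2 from rfl]; ring, add_pow]
    apply Finset.sum_congr rfl
    intro j _
    simp only [map_pow, map_add, map_one, expand_X, map_mul, mul_pow]
    rw [show (C (n.choose j) : ℕ[X]) = (n.choose j : ℕ[X]) from by simp]
    ring
  rw [← h1, h2, finsetSum_coeff]
  trans ∑ k ∈ Finset.range (n/2+1), n.choose (2*k) * 2^(n-2*k) * (2*k).choose (2*k/2)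
  · rw [← sum_even n (fun j => n.choose j * 2^(n-j) * j.choose (j/2))]
    apply Finset.sum_congr rfl
    intro j hj
    have hj' : j ≤ n := by simp at hj; omega
    rw [coeff_C_mul, coeff_mul_X_pow', if_pos (by omega), Nat.sub_sub_self hj',
      coeff_expand (by norm_num)]
    split_ifs <;> simp [coeff_one_add_X_pow]
  · apply Finset.sum_congr rfl
    intro k _
    simp

/-- the identity
c_n = Σ_{k=0}^{⌊n/2⌋} C(n, n−2k)² · c_k² · (n−2k)!, counting n-connectors
according to the number r = n−2k of pairs joining top to bottom. -/
theorem statement13 (n : ℕ) :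
    connCount n = ∑ k ∈ Finset.range (n/2 + 1),
      (n.choose (n - 2*k))^2 * (connCount k)^2 * Nat.factorial (n - 2*k) := by
  have key : ∀ m, connCount m * 2^m = (2*m).choose m * m.factorial := by
    intro m
    have h := Nat.choose_mul_factorial_mul_factorial (show m ≤ 2*m by omega)
    rw [show 2*m - m = m by omega, ← cc_mul m] at h
    apply Nat.eq_of_mul_eq_mul_right (Nat.factorial_pos m)
    rw [h]; ring
  apply Nat.eq_of_mul_eq_mul_right (show 0 < 2^n by positivity)
  rw [key, central, Finset.sum_mul, Finset.sum_mul]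
  apply Finset.sum_congr rfl
  intro k hk
  have hk' : 2*k ≤ n := by simp at hk; omega
  rw [Nat.choose_symm hk']
  have h := Nat.choose_mul_factorial_mul_factorial hk'
  have hc := cc_mul k
  have h3 := key k
  obtain ⟨d, rfl⟩ := Nat.exists_eq_add_of_le hk'
  rw [show 2*k+d-2*k = d by omega] at *
  rw [← h, ← hc, pow_add, pow_mul]
  calc _ = (2*k+d).choose (2*k)^2 * 2^d * connCount k * 2^k * d.factorial *
        ((2*k).choose k * k.factorial) := by ring
    _ = _ := by
      rw [← h3, show (2^2 : ℕ)^k = 2^k * 2^k by rw [← mul_pow]; norm_num]; ring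
end

section
/- Let π ∈ S_n have inversion number ℓ = ℓ(π), and let (i_1, …, i_ℓ) and (j_1, …, j_ℓ) be two reduced expressions for π, i.e., π = τ_{i_1} ∘ τ_{i_2} ∘ ⋯ ∘ τ_{i_ℓ} = τ_{j_1} ∘ ⋯ ∘ τ_{j_ℓ} where τ_i = (i, i+1). Then σ_{i_1} σ_{i_2} ⋯ σ_{i_ℓ} = σ_{j_1} σ_{j_2} ⋯ σ_{j_ℓ} in the braid group B_n. Hence the positive permutation braid β_π := σ_{i_ℓ} σ_{i_{ℓ−1}} ⋯ σ_{i_1} is well-defined, depending only on the permutation π. -/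
noncomputable section

/-- The defining relators of the braid group B_n on generators σ₁, …, σ_{n−1}
(generators with index outside 1 ≤ i ≤ n−1 are killed, so the presented group
is exactly Artin's braid group on n strands). -/
def braidRels (n : ℕ) : Set (FreeGroup ℕ) :=
  {w | ∃ i : ℕ, ¬(1 ≤ i ∧ i < n) ∧ w = FreeGroup.of i} ∪
  {w | ∃ i : ℕ, 1 ≤ i ∧ i + 1 < n ∧
      w = FreeGroup.of i * FreeGroup.of (i+1) * FreeGroup.of i *
        (FreeGroup.of (i+1) * FreeGroup.of i * FreeGroup.of (i+1))⁻¹} ∪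
  {w | ∃ i j : ℕ, 1 ≤ i ∧ i < n ∧ 1 ≤ j ∧ j < n ∧ i + 1 < j ∧
      w = FreeGroup.of i * FreeGroup.of j * (FreeGroup.of j * FreeGroup.of i)⁻¹}

/-- The braid group B_n on n strands. -/
abbrev BraidGroup (n : ℕ) : Type := PresentedGroup (braidRels n)

/-- The braid generator σᵢ ∈ B_n. -/
def braidSigma (n i : ℕ) : BraidGroup n := PresentedGroup.of i

/-- The product σ_{i₁} σ_{i₂} ⋯ σ_{i_m} ∈ B_n of the generators listed in `l`. -/
def braidWord (n : ℕ) (l : List ℕ) : BraidGroup n := (l.map (braidSigma n)).prod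

/-- The adjacent transposition τᵢ = (i, i+1), as a permutation of ℕ.
Permutations in S_n are modelled as permutations of ℕ supported on {1, …, n}. -/
def tauPerm (i : ℕ) : Equiv.Perm ℕ := Equiv.swap i (i+1)

/-- The number of inversions ℓ(π) of a permutation π ∈ S_n (supported on {1, …, n}). -/
def invNum (n : ℕ) (π : Equiv.Perm ℕ) : ℕ :=
  ((Finset.Icc 1 n ×ˢ Finset.Icc 1 n).filter fun p => p.1 < p.2 ∧ π p.2 < π p.1).card

/-- `is` is a reduced expression for π ∈ S_n: π = τ_{i₁} ∘ τ_{i₂} ∘ ⋯ ∘ τ_{i_ℓ}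
with each 1 ≤ i ≤ n−1 and ℓ = ℓ(π) the inversion number of π. -/
def IsReducedWord (n : ℕ) (π : Equiv.Perm ℕ) (is : List ℕ) : Prop :=
  (∀ i ∈ is, 1 ≤ i ∧ i < n) ∧ (is.map tauPerm).prod = π ∧ is.length = invNum n π

/-- The positive permutation braid β_π = σ_{i_ℓ} σ_{i_{ℓ−1}} ⋯ σ_{i₁} ∈ B_n,
given from a chosen reduced expression (i₁, …, i_ℓ) for π; by Tits' theorem it
does not depend on this choice. -/
noncomputable def posPermBraid (n : ℕ) (π : Equiv.Perm ℕ) : BraidGroup n :=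
  letI := Classical.propDecidable (∃ is : List ℕ, IsReducedWord n π is)
  if h : ∃ is : List ℕ, IsReducedWord n π is then braidWord n h.choose.reverse else 1

theorem tau_self (i : ℕ) : tauPerm i * tauPerm i = 1 := by
  simp [tauPerm]

theorem tau_comm (i j : ℕ) (h : i + 1 < j) :
    tauPerm i * tauPerm j = tauPerm j * tauPerm i := by
  ext x
  simp only [tauPerm, Equiv.Perm.mul_apply, Equiv.swap_apply_def]
  grind

theorem tau_braid (i : ℕ) : tauPerm i * tauPerm (i+1) * tauPerm i =
    tauPerm (i+1) * tauPerm i * tauPerm (i+1) := by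
  ext x
  simp only [tauPerm, Equiv.Perm.mul_apply, Equiv.swap_apply_def]
  grind

theorem invNum_asc (n : ℕ) (π : Equiv.Perm ℕ) (i : ℕ) (h1 : 1 ≤ i) (h2 : i < n)
    (h : π i < π (i+1)) : invNum n (π * tauPerm i) = invNum n π + 1 := by
  unfold invNum
  set e : ℕ × ℕ ≃ ℕ × ℕ := Equiv.prodCongr (tauPerm i) (tauPerm i) with he
  set A := ((Finset.Icc 1 n ×ˢ Finset.Icc 1 n).filter fun p => p.1 < p.2 ∧ π p.2 < π p.1)
    with hA
  have hmem : ∀ p : ℕ × ℕ, p ∈ A.map e.toEmbedding ↔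
      (tauPerm i p.1, tauPerm i p.2) ∈ A := by
    intro p
    rw [Finset.mem_map_equiv]
    simp [he, tauPerm, Prod.map]
  have hnot : (i, i+1) ∉ A.map e.toEmbedding := by
    rw [hmem]
    simp [hA, tauPerm]
  rw [← Finset.card_map e.toEmbedding (s := A), ← Finset.card_insert_of_notMem hnot]
  congr 1
  ext ⟨a, b⟩
  rw [Finset.mem_insert, hmem]
  simp only [hA, tauPerm, Finset.mem_filter, Finset.mem_product, Finset.mem_Icc,
    Equiv.Perm.mul_apply, Equiv.swap_apply_def, Prod.mk.injEq]
  grind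

theorem invNum_desc (n : ℕ) (π : Equiv.Perm ℕ) (i : ℕ) (h1 : 1 ≤ i) (h2 : i < n)
    (h : π (i+1) < π i) : invNum n π = invNum n (π * tauPerm i) + 1 := by
  have := invNum_asc n (π * tauPerm i) i h1 h2 (by simpa [tauPerm] using h)
  rwa [mul_assoc, tau_self, mul_one] at this

theorem invNum_mul_le (n : ℕ) (π : Equiv.Perm ℕ) (i : ℕ) (h1 : 1 ≤ i) (h2 : i < n) :
    invNum n (π * tauPerm i) ≤ invNum n π + 1 := by
  rcases lt_trichotomy (π i) (π (i+1)) with h | h | h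
  · exact (invNum_asc n π i h1 h2 h).le
  · simp at h
  · have := invNum_desc n π i h1 h2 h
    omega

theorem invNum_one (n : ℕ) : invNum n 1 = 0 := by
  unfold invNum
  rw [Finset.card_eq_zero, Finset.filter_eq_empty_iff]
  rintro p _ ⟨h, h'⟩
  simp at h'
  omega

theorem invNum_le_length (n : ℕ) (l : List ℕ) (hl : ∀ i ∈ l, 1 ≤ i ∧ i < n) :
    invNum n (l.map tauPerm).prod ≤ l.length := by
  induction l using List.reverseRecOn with
  | nil => simp [invNum_one]
  | append_singleton u i ih =>
    have hi := hl i (by simp)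
    have := ih (fun k hk => hl k (by simp [hk]))
    have h2 := invNum_mul_le n (u.map tauPerm).prod i hi.1 hi.2
    simp at *
    omega

theorem reduced_append {n : ℕ} {π : Equiv.Perm ℕ} {u : List ℕ} {i : ℕ}
    (h : IsReducedWord n π (u ++ [i])) :
    1 ≤ i ∧ i < n ∧ π (i+1) < π i ∧ IsReducedWord n (π * tauPerm i) u := by
  obtain ⟨h1, h2, h3⟩ := h
  have hi := h1 i (by simp)
  have hu : ∀ k ∈ u, 1 ≤ k ∧ k < n := fun k hk => h1 k (by simp [hk])
  have hp : (u.map tauPerm).prod = π * tauPerm i := by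
    rw [← h2]; simp [mul_assoc, tau_self]
  have hle := invNum_le_length n u hu
  rw [hp] at hle
  simp at h3
  have hd : π (i+1) < π i := by
    rcases lt_trichotomy (π i) (π (i+1)) with h | h | h
    · have := invNum_asc n π i hi.1 hi.2 h
      omega
    · simp at h
    · exact h
  have := invNum_desc n π i hi.1 hi.2 hd
  exact ⟨hi.1, hi.2, hd, hu, hp, by omega⟩

theorem reduced_snoc {n : ℕ} {π : Equiv.Perm ℕ} {u : List ℕ} {i : ℕ}
    (h1 : 1 ≤ i) (h2 : i < n) (hd : π (i+1) < π i)
    (h : IsReducedWord n (π * tauPerm i) u) : IsReducedWord n π (u ++ [i]) := by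
  obtain ⟨h3, h4, h5⟩ := h
  refine ⟨?_, ?_, ?_⟩
  · intro k hk
    rcases List.mem_append.1 hk with hk | hk
    · exact h3 k hk
    · simp at hk; subst hk; exact ⟨h1, h2⟩
  · simp [h4, mul_assoc, tau_self]
  · have := invNum_desc n π i h1 h2 hd
    simp; omega

theorem supp_tau {n : ℕ} {π : Equiv.Perm ℕ} (hπ : ∀ x : ℕ, x = 0 ∨ n < x → π x = x)
    {i : ℕ} (h1 : 1 ≤ i) (h2 : i < n) :
    ∀ x : ℕ, x = 0 ∨ n < x → (π * tauPerm i) x = x := by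
  intro x hx
  have : tauPerm i x = x := by
    rw [tauPerm, Equiv.swap_apply_of_ne_of_ne] <;> omega
  rw [Equiv.Perm.mul_apply, this, hπ x hx]

theorem exists_reduced (n k : ℕ) : ∀ (π : Equiv.Perm ℕ)
    (_ : ∀ x : ℕ, x = 0 ∨ n < x → π x = x) (_ : invNum n π = k),
    ∃ w, IsReducedWord n π w := by
  induction k using Nat.strong_induction_on with
  | _ k ih =>
  intro π hπ hk
  by_cases hd : ∃ i, 1 ≤ i ∧ i < n ∧ π (i+1) < π i
  · obtain ⟨i, h1, h2, h3⟩ := hd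
    have := invNum_desc n π i h1 h2 h3
    obtain ⟨w, hw⟩ := ih _ (by omega) (π * tauPerm i) (supp_tau hπ h1 h2) rfl
    exact ⟨_, reduced_snoc h1 h2 h3 hw⟩
  · push Not at hd
    have hle : ∀ x, π x < π (x+1) := by
      intro x
      rcases Nat.eq_zero_or_pos x with rfl | hx
      · rw [hπ 0 (Or.inl rfl)]
        rcases Nat.eq_zero_or_pos (π (0+1)) with h | h
        · have := π.injective (h.trans (hπ 0 (Or.inl rfl)).symm)
          omega
        · exact h
      · rcases lt_or_ge x n with hxn | hxn
        · exact lt_of_le_of_ne (hd x hx hxn) (by simp)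
        · have h1 := hπ (x+1) (Or.inr (by omega))
          rw [h1]
          by_contra hc
          have h2 := hπ (π x) (Or.inr (by omega))
          have h3 := π.injective h2
          omega
    have hmono : StrictMono π := strictMono_nat_of_lt_succ hle
    have hone : π = 1 := by
      ext x
      have h1 := hmono.le_apply (x := x)
      have hinv : StrictMono π.symm := by
        intro a b hab
        rw [← hmono.lt_iff_lt]; simpa using hab
      have h2 := hinv.le_apply (x := π x)
      simp at h2
      simp; omega
    subst hone
    exact ⟨[], by simp, by simp, by simp [invNum_one]⟩

theorem tits_gen {M : Type*} [Monoid M] (n : ℕ) (f : ℕ → M)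
    (hb : ∀ i, 1 ≤ i → i + 1 < n → f i * f (i+1) * f i = f (i+1) * f i * f (i+1))
    (hc : ∀ i j, 1 ≤ i → j < n → i + 1 < j → f i * f j = f j * f i) (k : ℕ) :
    ∀ (π : Equiv.Perm ℕ) (_ : ∀ x : ℕ, x = 0 ∨ n < x → π x = x) (is js : List ℕ)
      (_ : IsReducedWord n π is) (_ : IsReducedWord n π js) (_ : invNum n π = k),
      (is.map f).prod = (js.map f).prod := by
  induction k using Nat.strong_induction_on with
  | _ k ih =>
  intro π hπ is js his hjs hk
  rcases List.eq_nil_or_concat' is with rfl | ⟨u, i, rfl⟩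
  · have h1 := his.2.2
    have h2 := hjs.2.2
    have : js = [] := List.length_eq_zero_iff.1 (by simp at h1; omega)
    rw [this]
  rcases List.eq_nil_or_concat' js with rfl | ⟨v, j, rfl⟩
  · have h1 := his.2.2
    have h2 := hjs.2.2
    simp at h1 h2
    omega
  obtain ⟨hi1, hi2, hid, hu⟩ := reduced_append his
  obtain ⟨hj1, hj2, hjd, hv⟩ := reduced_append hjs
  clear his hjs
  have hwlog : ∀ i j u v, 1 ≤ i → j < n → π (i+1) < π i → π (j+1) < π j → i < j →
      IsReducedWord n (π * tauPerm i) u → IsReducedWord n (π * tauPerm j) v →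
      ((u ++ [i]).map f).prod = ((v ++ [j]).map f).prod := by
    clear hi1 hi2 hid hu hj1 hj2 hjd hv i j u v
    intro i j u v hi1 hj2 hid hjd hij hu hv
    have hi2 : i < n := by omega
    have hj1 : 1 ≤ j := by omega
    have hsi := supp_tau hπ hi1 hi2
    have hsj := supp_tau hπ hj1 hj2
    have hni := invNum_desc n π i hi1 hi2 hid
    have hnj := invNum_desc n π j hj1 hj2 hjd
    rcases Nat.lt_or_ge (i+1) j with hlt | hge
    · have hdi : (π * tauPerm j) (i+1) < (π * tauPerm j) i := by
        simp only [Equiv.Perm.mul_apply, tauPerm, Equiv.swap_apply_def]; grind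
      have hdj : (π * tauPerm i) (j+1) < (π * tauPerm i) j := by
        simp only [Equiv.Perm.mul_apply, tauPerm, Equiv.swap_apply_def]; grind
      obtain ⟨w, hw⟩ := exists_reduced n _ _ (supp_tau hsi hj1 hj2) rfl
      have e1 := ih _ (by omega) _ hsi u _ hu (reduced_snoc hj1 hj2 hdj hw) rfl
      rw [mul_assoc, tau_comm i j hlt, ← mul_assoc] at hw
      have e2 := ih _ (by omega) _ hsj v _ hv (reduced_snoc hi1 hi2 hdi hw) rfl
      simp only [List.map_append, List.prod_append, e1, e2]
      simp [mul_assoc, hc i j hi1 hj2 hlt]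
    · obtain rfl : j = i + 1 := by omega
      have hdj : (π * tauPerm i) (i+1+1) < (π * tauPerm i) (i+1) := by
        simp only [Equiv.Perm.mul_apply, tauPerm, Equiv.swap_apply_def]; grind
      have hdi : (π * tauPerm (i+1)) (i+1) < (π * tauPerm (i+1)) i := by
        simp only [Equiv.Perm.mul_apply, tauPerm, Equiv.swap_apply_def]; grind
      have hdj2 : (π * tauPerm i * tauPerm (i+1)) (i+1) <
          (π * tauPerm i * tauPerm (i+1)) i := by
        simp only [Equiv.Perm.mul_apply, tauPerm, Equiv.swap_apply_def]; grind
      have hdi2 : (π * tauPerm (i+1) * tauPerm i) (i+1+1) <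
          (π * tauPerm (i+1) * tauPerm i) (i+1) := by
        simp only [Equiv.Perm.mul_apply, tauPerm, Equiv.swap_apply_def]; grind
      obtain ⟨w, hw⟩ := exists_reduced n _ _
        (supp_tau (supp_tau hsi hj1 hj2) hi1 hi2) rfl
      have e1 := ih _ (by omega) _ hsi u _ hu
        (reduced_snoc hj1 hj2 hdj (reduced_snoc hi1 hi2 hdj2 hw)) rfl
      have hw' : IsReducedWord n (π * tauPerm (i+1) * tauPerm i * tauPerm (i+1)) w := by
        have h := tau_braid i
        have h' : π * tauPerm (i+1) * tauPerm i * tauPerm (i+1) =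
            π * tauPerm i * tauPerm (i+1) * tauPerm i := by
          simp only [mul_assoc] at h ⊢
          rw [h]
        rw [h']; exact hw
      have e2 := ih _ (by omega) _ hsj v _ hv
        (reduced_snoc hi1 hi2 hdi (reduced_snoc hj1 hj2 hdi2 hw')) rfl
      have h := hb i hi1 hj2
      simp only [List.map_append, List.prod_append, e1, e2]
      simp only [List.map_cons, List.map_nil, List.prod_singleton]
      simp only [mul_assoc] at h ⊢
      rw [h]
  rcases lt_trichotomy i j with h | h | h
  · exact hwlog i j u v hi1 hj2 hid hjd h hu hv
  · subst h
    have hni := invNum_desc n π i hi1 hi2 hid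
    have e := ih _ (by omega) _ (supp_tau hπ hi1 hi2) u v hu hv rfl
    simp [e]
  · exact (hwlog j i v u hj1 hi2 hjd hid h hv hu).symm

theorem sigma_braid (n i : ℕ) (h1 : 1 ≤ i) (h2 : i + 1 < n) :
    braidSigma n i * braidSigma n (i+1) * braidSigma n i =
    braidSigma n (i+1) * braidSigma n i * braidSigma n (i+1) := by
  have := PresentedGroup.one_of_mem (rels := braidRels n)
    (Or.inl (Or.inr ⟨i, h1, h2, rfl⟩))
  rw [map_mul, map_inv, mul_inv_eq_one] at this
  simp only [map_mul] at this
  exact this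

theorem sigma_comm (n i j : ℕ) (h1 : 1 ≤ i) (h2 : j < n) (h : i + 1 < j) :
    braidSigma n i * braidSigma n j = braidSigma n j * braidSigma n i := by
  have := PresentedGroup.one_of_mem (rels := braidRels n)
    (Or.inr ⟨i, j, h1, by omega, by omega, h2, h, rfl⟩)
  rw [map_mul, map_inv, mul_inv_eq_one] at this
  simp only [map_mul] at this
  exact this

/-- Tits: if (i₁, …, i_ℓ) and (j₁, …, j_ℓ) are two reduced
expressions for π ∈ S_n (ℓ = ℓ(π) the inversion number), then
σ_{i₁} ⋯ σ_{i_ℓ} = σ_{j₁} ⋯ σ_{j_ℓ} in the braid group B_n; hence the positive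
permutation braid β_π = σ_{i_ℓ} ⋯ σ_{i₁} is well-defined, depending only on π. -/
theorem statement15 (n : ℕ) (π : Equiv.Perm ℕ)
    (hπ : ∀ x : ℕ, x = 0 ∨ n < x → π x = x)
    (is js : List ℕ) (his : IsReducedWord n π is) (hjs : IsReducedWord n π js) :
    braidWord n is = braidWord n js ∧
    braidWord n is.reverse = braidWord n js.reverse := by
  constructor
  · exact tits_gen n (braidSigma n) (sigma_braid n) (sigma_comm n) _ π hπ is js his hjs rfl
  · have key := tits_gen n (fun i => MulOpposite.op (braidSigma n i))
      (fun i h1 h2 => by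
        have := sigma_braid n i h1 h2
        simp only [← MulOpposite.op_mul]
        simp only [mul_assoc] at this ⊢
        rw [this])
      (fun i j h1 h2 h => by
        simp only [← MulOpposite.op_mul]
        rw [sigma_comm n i j h1 h2 h]) _ π hπ is js his hjs rfl
    have conv : ∀ l : List ℕ, (l.map (fun i => MulOpposite.op (braidSigma n i))).prod =
        MulOpposite.op (braidWord n l.reverse) := by
      intro l
      induction l with
      | nil => simp [braidWord]
      | cons a l ih =>
        rw [List.map_cons, List.prod_cons, ih, ← MulOpposite.op_mul]
        simp [braidWord]
    rw [conv, conv] at key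
    exact MulOpposite.op_injective key
end
end
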